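/- arXiv:1904.02361 — 5 statements merged into one kernel-verified Lean document; each statement's English description precedes it below -/
import Mathlib

section
/- Let Z be a nonempty finite type, let α > 0 be a real number, and let p₁, p₂ be probability mass functions on Z with p₁(z) > 0 and p₂(z) > 0 for all z. Define Z_α = ∑_z p₁(z)^{1/(α+1)} · p₂(z)^{α/(α+1)} and the normalized weighted geometric mean q_α(z) = p₁(z)^{1/(α+1)} · p₂(z)^{α/(α+1)} / Z_α. Then for every probability mass function q on Z, KL(q ‖ p₁) + α · KL(q ‖ p₂) ≥ KL(q_α ‖ p₁) + α · KL(q_α ‖ p₂); that is, q_α minimizes the objective q ↦ KL(q ‖ p₁) + α · KL(q ‖ p₂) over all probability mass functions on Z. -/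
open Real BigOperators Finset

/-- Kullback–Leibler divergence between probability mass functions on a finite type,
with the summand taken to be `0` whenever `q z = 0`. -/
noncomputable def KLfin {Z : Type*} [Fintype Z] (q p : Z → ℝ) : ℝ :=
  ∑ z, if q z = 0 then 0 else q z * Real.log (q z / p z)

/-- The `if` in `KLfin` is redundant, since `0 * log (0 / p) = 0`. -/
lemma KLfin_eq_sum {Z : Type*} [Fintype Z] (q p : Z → ℝ) :
    KLfin q p = ∑ z, q z * Real.log (q z / p z) := by
  refine Finset.sum_congr rfl fun z _ => ?_
  split_ifs with h <;> simp [h]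

/-- Gibbs' inequality. -/
lemma KLfin_nonneg {Z : Type*} [Fintype Z] {q p : Z → ℝ} (hq : ∀ z, 0 ≤ q z)
    (hp : ∀ z, 0 < p z) (h : ∑ z, p z ≤ ∑ z, q z) : 0 ≤ KLfin q p := by
  have key : ∑ z, (q z - p z) ≤ KLfin q p := by
    rw [KLfin_eq_sum]
    refine Finset.sum_le_sum fun z _ => ?_
    rcases (hq z).eq_or_lt with h0 | h0
    · simp [← h0, (hp z).le]
    · have hl := Real.one_sub_inv_le_log_of_pos (div_pos h0 (hp z))
      have hm := mul_le_mul_of_nonneg_left hl h0.le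
      have he : q z * (1 - (q z / p z)⁻¹) = q z - p z := by
        field_simp
      linarith
  rw [Finset.sum_sub_distrib] at key
  linarith

lemma KLfin_self {Z : Type*} [Fintype Z] {q : Z → ℝ} (hq : ∀ z, q z ≠ 0) : KLfin q q = 0 := by
  simp [KLfin_eq_sum, hq]

/-- The weighted objective is, up to scaling and an additive constant, the divergence from the
normalized weighted geometric mean. -/
lemma KLfin_add_mul_KLfin {Z : Type*} [Fintype Z] {α c : ℝ} (hα : 0 < α) (hc : 0 < c)
    {p₁ p₂ q : Z → ℝ} (hp₁ : ∀ z, 0 < p₁ z) (hp₂ : ∀ z, 0 < p₂ z) (hq : ∑ z, q z = 1) :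
    KLfin q p₁ + α * KLfin q p₂ =
      (α + 1) * (KLfin q (fun z => p₁ z ^ (1 / (α + 1)) * p₂ z ^ (α / (α + 1)) / c) -
        Real.log c) := by
  have hlog : Real.log c = ∑ z, q z * Real.log c := by rw [← Finset.sum_mul, hq, one_mul]
  rw [hlog]
  simp only [KLfin_eq_sum]
  rw [← Finset.sum_sub_distrib, Finset.mul_sum, Finset.mul_sum, ← Finset.sum_add_distrib]
  refine Finset.sum_congr rfl fun z _ => ?_
  by_cases h0 : q z = 0
  · simp [h0]
  have h₁ := Real.rpow_pos_of_pos (hp₁ z) (1 / (α + 1))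
  have h₂ := Real.rpow_pos_of_pos (hp₂ z) (α / (α + 1))
  rw [Real.log_div h0 (hp₁ z).ne', Real.log_div h0 (hp₂ z).ne',
    Real.log_div h0 (div_pos (mul_pos h₁ h₂) hc).ne', Real.log_div (mul_pos h₁ h₂).ne' hc.ne',
    Real.log_mul h₁.ne' h₂.ne', Real.log_rpow (hp₁ z), Real.log_rpow (hp₂ z)]
  field_simp
  ring

/-- The normalized weighted geometric mean `q_α` minimizes
`q ↦ KL(q ‖ p₁) + α · KL(q ‖ p₂)` over probability mass functions on `Z`. -/
theorem geometric_mean_minimizes_weighted_KL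
    {Z : Type*} [Fintype Z] [Nonempty Z] (α : ℝ) (hα : 0 < α)
    (p₁ p₂ : Z → ℝ) (hp₁ : ∀ z, 0 < p₁ z) (hp₂ : ∀ z, 0 < p₂ z)
    (hs₁ : ∑ z, p₁ z = 1) (hs₂ : ∑ z, p₂ z = 1)
    (Zα : ℝ) (hZα : Zα = ∑ z, p₁ z ^ (1 / (α + 1)) * p₂ z ^ (α / (α + 1)))
    (qα : Z → ℝ)
    (hqα : ∀ z, qα z = p₁ z ^ (1 / (α + 1)) * p₂ z ^ (α / (α + 1)) / Zα)
    (q : Z → ℝ) (hq0 : ∀ z, 0 ≤ q z) (hq1 : ∑ z, q z = 1) :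
    KLfin q p₁ + α * KLfin q p₂ ≥ KLfin qα p₁ + α * KLfin qα p₂ := by
  have hg : ∀ z, 0 < p₁ z ^ (1 / (α + 1)) * p₂ z ^ (α / (α + 1)) := fun z =>
    mul_pos (Real.rpow_pos_of_pos (hp₁ z) _) (Real.rpow_pos_of_pos (hp₂ z) _)
  have hZ : 0 < Zα := hZα ▸ Finset.sum_pos (fun z _ => hg z) Finset.univ_nonempty
  have hpos : ∀ z, 0 < qα z := fun z => hqα z ▸ div_pos (hg z) hZ
  have hsum : ∑ z, qα z = 1 := by
    simp only [hqα]
    rw [← Finset.sum_div, ← hZα, div_self hZ.ne']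
  rw [KLfin_add_mul_KLfin hα hZ hp₁ hp₂ hq1, KLfin_add_mul_KLfin hα hZ hp₁ hp₂ hsum,
    ← funext hqα, KLfin_self fun z => (hpos z).ne']
  have hKL := KLfin_nonneg hq0 hpos (by rw [hsum, hq1])
  gcongr
end

section
/- Let Z be a nonempty finite type, let α > 0 be a real number, and let p₁, p₂ be probability mass functions on Z with p₁(z) > 0 and p₂(z) > 0 for all z. Define Z_α = ∑_z p₁(z)^{1/(α+1)} · p₂(z)^{α/(α+1)} and q_α(z) = p₁(z)^{1/(α+1)} · p₂(z)^{α/(α+1)} / Z_α. Then for every probability mass function q on Z, the decomposition KL(q ‖ p₁) + α · KL(q ‖ p₂) = (α+1) · KL(q ‖ q_α) − (α+1) · log Z_α holds. -/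
open Real BigOperators Finset

/-- Decomposition: `KL(q ‖ p₁) + α · KL(q ‖ p₂) = (α+1) · KL(q ‖ q_α) − (α+1) · log Z_α`. -/
theorem weighted_KL_decomposition
    {Z : Type*} [Fintype Z] [Nonempty Z] (α : ℝ) (hα : 0 < α)
    (p₁ p₂ : Z → ℝ) (hp₁ : ∀ z, 0 < p₁ z) (hp₂ : ∀ z, 0 < p₂ z)
    (hs₁ : ∑ z, p₁ z = 1) (hs₂ : ∑ z, p₂ z = 1)
    (Zα : ℝ) (hZα : Zα = ∑ z, p₁ z ^ (1 / (α + 1)) * p₂ z ^ (α / (α + 1)))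
    (qα : Z → ℝ)
    (hqα : ∀ z, qα z = p₁ z ^ (1 / (α + 1)) * p₂ z ^ (α / (α + 1)) / Zα)
    (q : Z → ℝ) (hq0 : ∀ z, 0 ≤ q z) (hq1 : ∑ z, q z = 1) :
    KLfin q p₁ + α * KLfin q p₂ = (α + 1) * KLfin q qα - (α + 1) * Real.log Zα := by
  have hpos : ∀ z, 0 < p₁ z ^ (1 / (α + 1)) * p₂ z ^ (α / (α + 1)) := fun z =>
    mul_pos (rpow_pos_of_pos (hp₁ z) _) (rpow_pos_of_pos (hp₂ z) _)
  have hZ : 0 < Zα := by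
    rw [hZα]
    exact Finset.sum_pos (fun z _ => hpos z) Finset.univ_nonempty
  have hlog : (α + 1) * Real.log Zα = ∑ z, q z * ((α + 1) * Real.log Zα) := by
    rw [← Finset.sum_mul, hq1, one_mul]
  rw [hlog]
  unfold KLfin
  rw [Finset.mul_sum, Finset.mul_sum, ← Finset.sum_add_distrib, ← Finset.sum_sub_distrib]
  refine Finset.sum_congr rfl fun z _ => ?_
  by_cases hz : q z = 0
  · simp [hz]
  · have hq : 0 < qα z := by
      rw [hqα]
      exact div_pos (hpos z) hZ
    have hlogq : Real.log (qα z) =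
        1 / (α + 1) * Real.log (p₁ z) + α / (α + 1) * Real.log (p₂ z) - Real.log Zα := by
      rw [hqα, Real.log_div (hpos z).ne' hZ.ne',
        Real.log_mul (rpow_pos_of_pos (hp₁ z) _).ne' (rpow_pos_of_pos (hp₂ z) _).ne',
        Real.log_rpow (hp₁ z), Real.log_rpow (hp₂ z)]
    simp only [if_neg hz]
    rw [Real.log_div hz (hp₁ z).ne', Real.log_div hz (hp₂ z).ne', Real.log_div hz hq.ne', hlogq]
    have hα1 : α + 1 ≠ 0 := by positivity
    field_simp
    ring
end

section
/- Let μ₁, μ₂ ∈ ℝ, let v > 0 (a positive real variance), and let α > 0. Let f_i denote the Lebesgue density of the Gaussian probability measure gaussianReal μ_i v on ℝ, i.e., f_i(z) = (2πv)^{-1/2} exp(−(z − μ_i)²/(2v)). Then the probability measure on ℝ whose density with respect to Lebesgue measure is z ↦ (f₁(z) · f₂(z)^α)^{1/(α+1)} / ∫_ℝ (f₁(w) · f₂(w)^α)^{1/(α+1)} dw equals the Gaussian measure gaussianReal ((μ₁ + α·μ₂)/(α+1)) v. -/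
open Real MeasureTheory ProbabilityTheory

/-- The weighted geometric mean of two Gaussian densities with common variance is proportional to
the Gaussian density with the same variance centred at the weighted average of the means. -/
lemma gaussianPDFReal_mul_rpow_rpow (μ₁ μ₂ : ℝ) {v : NNReal} (hv : v ≠ 0) {α : ℝ}
    (hα : α + 1 ≠ 0) (z : ℝ) :
    (gaussianPDFReal μ₁ v z * gaussianPDFReal μ₂ v z ^ α) ^ (1 / (α + 1)) =
      Real.exp (-(α * (μ₁ - μ₂) ^ 2) / (2 * v * (α + 1) ^ 2)) *
        gaussianPDFReal ((μ₁ + α * μ₂) / (α + 1)) v z := by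
  have hv' : (v : ℝ) ≠ 0 := NNReal.coe_ne_zero.mpr hv
  have hC : 0 < (√(2 * π * v))⁻¹ := by positivity
  simp only [gaussianPDFReal]
  rw [← Real.exp_log hC]
  simp only [← Real.exp_add, ← Real.exp_mul]
  congr 1
  field_simp
  ring

/-- Measure-theoretic form of Theorem 2 in one dimension: the probability measure whose
Lebesgue density is the normalized weighted geometric mean of the densities of
`gaussianReal μ₁ v` and `gaussianReal μ₂ v` equals `gaussianReal ((μ₁ + α μ₂)/(α+1)) v`. -/
theorem gaussian_geometric_mean_measure
    (μ₁ μ₂ : ℝ) (v : NNReal) (hv : 0 < v) (α : ℝ) (hα : 0 < α)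
    (f₁ f₂ : ℝ → ℝ)
    (hf₁ : ∀ z, f₁ z = (2 * π * (v : ℝ)) ^ (-(1 : ℝ) / 2) *
      Real.exp (-(z - μ₁) ^ 2 / (2 * (v : ℝ))))
    (hf₂ : ∀ z, f₂ z = (2 * π * (v : ℝ)) ^ (-(1 : ℝ) / 2) *
      Real.exp (-(z - μ₂) ^ 2 / (2 * (v : ℝ)))) :
    volume.withDensity
        (fun z => ENNReal.ofReal
          ((f₁ z * f₂ z ^ α) ^ (1 / (α + 1)) /
            ∫ w, (f₁ w * f₂ w ^ α) ^ (1 / (α + 1)))) =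
      gaussianReal ((μ₁ + α * μ₂) / (α + 1)) v := by
  have hv₀ : v ≠ 0 := hv.ne'
  have hpdf (μ z : ℝ) : (2 * π * (v : ℝ)) ^ (-(1 : ℝ) / 2) *
      Real.exp (-(z - μ) ^ 2 / (2 * (v : ℝ))) = gaussianPDFReal μ v z := by
    rw [gaussianPDFReal, Real.sqrt_eq_rpow, ← Real.rpow_neg (by positivity), neg_div]
  simp only [hf₁, hf₂, hpdf, gaussianPDFReal_mul_rpow_rpow μ₁ μ₂ hv₀ (by positivity : α + 1 ≠ 0),
    integral_const_mul, integral_gaussianPDFReal_eq_one _ hv₀, mul_one,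
    mul_div_cancel_left₀ _ (Real.exp_ne_zero _)]
  rw [gaussianReal_of_var_ne_zero _ hv₀, gaussianPDF_def]
end

section
/- Let (Ω, 𝓕, ν) be a measure space with ν σ-finite, let α > 0, and let f, f₁, f₂ : Ω → ℝ be nonnegative measurable functions with ∫ f dν = ∫ f₁ dν = ∫ f₂ dν = 1 and f₁ > 0, f₂ > 0 ν-almost everywhere. Suppose Z = ∫ f₁^{1/(α+1)} · f₂^{α/(α+1)} dν satisfies 0 < Z < ∞, define g = f₁^{1/(α+1)} · f₂^{α/(α+1)} / Z, and suppose the functions f·log(f/f₁), f·log(f/f₂), and f·log(f/g) are ν-integrable (with the integrand interpreted as 0 where f = 0). Then ∫ f·log(f/f₁) dν + α·∫ f·log(f/f₂) dν = (α+1)·∫ f·log(f/g) dν − (α+1)·log Z. -/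
open Real MeasureTheory

/-- The weighted sum of two pointwise relative entropy densities, expressed through the
normalized weighted geometric mean. -/
theorem mul_log_div_add_mul_log_div {x a b α Z : ℝ} (hx : 0 < x) (ha : 0 < a) (hb : 0 < b)
    (hα : 0 < α) (hZ : 0 < Z) :
    x * Real.log (x / a) + α * (x * Real.log (x / b)) =
      (α + 1) * (x * Real.log (x / (a ^ (1 / (α + 1)) * b ^ (α / (α + 1)) / Z))) -
        x * ((α + 1) * Real.log Z) := by
  have ha' := Real.rpow_pos_of_pos ha (1 / (α + 1))
  have hb' := Real.rpow_pos_of_pos hb (α / (α + 1))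
  rw [Real.log_div hx.ne' ha.ne', Real.log_div hx.ne' hb.ne',
    Real.log_div hx.ne' (by positivity), Real.log_div (by positivity) hZ.ne',
    Real.log_mul ha'.ne' hb'.ne', Real.log_rpow ha, Real.log_rpow hb]
  field_simp
  ring

/-- Density-level decomposition identity used in the proof of Theorem 1 of the paper:
for probability densities `f, f₁, f₂` w.r.t. a σ-finite measure `ν`, with `g` the
ν-normalized weighted geometric mean of `f₁` and `f₂`,
`KL(f‖f₁) + α·KL(f‖f₂) = (α+1)·KL(f‖g) − (α+1)·log Z`. -/
theorem density_weighted_KL_decomposition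
    {Ω : Type*} [MeasurableSpace Ω] (ν : Measure Ω) [SigmaFinite ν]
    (α : ℝ) (hα : 0 < α) (f f₁ f₂ : Ω → ℝ)
    (hfm : Measurable f) (hf₁m : Measurable f₁) (hf₂m : Measurable f₂)
    (hf0 : ∀ z, 0 ≤ f z) (hf₁0 : ∀ z, 0 ≤ f₁ z) (hf₂0 : ∀ z, 0 ≤ f₂ z)
    (hf1 : ∫ z, f z ∂ν = 1) (hf₁1 : ∫ z, f₁ z ∂ν = 1) (hf₂1 : ∫ z, f₂ z ∂ν = 1)
    (hf₁pos : ∀ᵐ z ∂ν, 0 < f₁ z) (hf₂pos : ∀ᵐ z ∂ν, 0 < f₂ z)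
    (hGint : Integrable (fun z => f₁ z ^ (1 / (α + 1)) * f₂ z ^ (α / (α + 1))) ν)
    (Z : ℝ) (hZ : Z = ∫ z, f₁ z ^ (1 / (α + 1)) * f₂ z ^ (α / (α + 1)) ∂ν)
    (hZpos : 0 < Z)
    (g : Ω → ℝ) (hg : ∀ z, g z = f₁ z ^ (1 / (α + 1)) * f₂ z ^ (α / (α + 1)) / Z)
    (hI₁ : Integrable (fun z => if f z = 0 then 0 else f z * Real.log (f z / f₁ z)) ν)
    (hI₂ : Integrable (fun z => if f z = 0 then 0 else f z * Real.log (f z / f₂ z)) ν)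
    (hIg : Integrable (fun z => if f z = 0 then 0 else f z * Real.log (f z / g z)) ν) :
    (∫ z, (if f z = 0 then 0 else f z * Real.log (f z / f₁ z)) ∂ν) +
      α * ∫ z, (if f z = 0 then 0 else f z * Real.log (f z / f₂ z)) ∂ν =
    (α + 1) * (∫ z, (if f z = 0 then 0 else f z * Real.log (f z / g z)) ∂ν) -
      (α + 1) * Real.log Z := by
  have hfi : Integrable f ν := by
    by_contra h
    rw [integral_undef h] at hf1
    exact zero_ne_one hf1
  rw [← integral_const_mul, ← integral_add hI₁ (hI₂.const_mul α), ← integral_const_mul,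
    show (α + 1) * Real.log Z = ∫ z, f z * ((α + 1) * Real.log Z) ∂ν by
      rw [integral_mul_const, hf1, one_mul],
    ← integral_sub (hIg.const_mul (α + 1)) (hfi.mul_const _)]
  refine integral_congr_ae ?_
  filter_upwards [hf₁pos, hf₂pos] with z h₁ h₂
  by_cases hz : f z = 0
  · simp [hz]
  · have hpos : 0 < f z := lt_of_le_of_ne (hf0 z) (Ne.symm hz)
    simp only [hz, if_false, hg]
    rw [← mul_log_div_add_mul_log_div hpos h₁ h₂ hα hZpos]
end

section
/- Let (Ω, 𝓕, ν) be a measure space with ν σ-finite, let α > 0, and let f₁, f₂ : Ω → ℝ be nonnegative measurable functions with ∫ f₁ dν = ∫ f₂ dν = 1 and f₁ > 0, f₂ > 0 ν-almost everywhere, and suppose Z = ∫ f₁^{1/(α+1)} · f₂^{α/(α+1)} dν satisfies 0 < Z < ∞. Define g = f₁^{1/(α+1)} · f₂^{α/(α+1)} / Z. Then for every nonnegative measurable f with ∫ f dν = 1 such that f·log(f/f₁) and f·log(f/f₂) are ν-integrable (integrand interpreted as 0 where f = 0), ∫ f·log(f/f₁) dν + α·∫ f·log(f/f₂) dν ≥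 ∫ g·log(g/f₁) dν + α·∫ g·log(g/f₂) dν; that is, g minimizes the objective f ↦ KL(f‖f₁) + α·KL(f‖f₂) over probability densities with respect to ν. -/
open Real MeasureTheory

lemma log_weighted_geom_mean_div {α a b Z : ℝ} (hα : 0 < α) (ha : 0 < a) (hb : 0 < b)
    (hZ : 0 < Z) :
    log (a ^ (1 / (α + 1)) * b ^ (α / (α + 1)) / Z) =
      (log a + α * log b) / (α + 1) - log Z := by
  rw [log_div (by positivity) hZ.ne', log_mul (by positivity) (by positivity),
    log_rpow ha, log_rpow hb]
  field_simp

lemma abs_log_le_rpow_div_add {r s t : ℝ} (hr : 0 < r) (hs : 0 < s) (ht : 0 < t) :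
    |log r| ≤ r ^ s / s + r ^ (-t) / t := by
  have h₁ := log_le_rpow_div hr.le hs
  have h₂ := log_le_rpow_div (inv_pos.2 hr).le ht
  rw [log_inv, inv_rpow hr.le, ← rpow_neg hr.le] at h₂
  have h₃ : 0 ≤ r ^ s / s := by positivity
  have h₄ : 0 ≤ r ^ (-t) / t := by positivity
  rw [abs_le]
  constructor <;> linarith

/-- The geometric mean with both weights positive absorbs the logarithm of the ratio. -/
lemma weighted_geom_mean_mul_abs_log_div_le {s t a b : ℝ} (hs : 0 < s) (ht : 0 < t)
    (hst : s + t = 1) (ha : 0 < a) (hb : 0 < b) :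
    a ^ s * b ^ t * |log (b / a)| ≤ b / s + a / t := by
  have h := mul_le_mul_of_nonneg_left (abs_log_le_rpow_div_add (div_pos hb ha) hs ht)
    (by positivity : 0 ≤ a ^ s * b ^ t)
  refine h.trans_eq ?_
  have hba : a ^ s * b ^ t * (b / a) ^ s = b := by
    rw [div_rpow hb.le ha.le, mul_assoc, mul_div_assoc', ← rpow_add hb, add_comm t s, hst,
      rpow_one, mul_div_cancel₀ _ (by positivity)]
  have hab : a ^ s * b ^ t * (b / a) ^ (-t) = a := by
    rw [div_rpow hb.le ha.le, rpow_neg hb.le, rpow_neg ha.le, inv_div_inv, mul_assoc,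
      mul_div_cancel₀ _ (by positivity), ← rpow_add ha, hst, rpow_one]
  rw [mul_add, mul_div_assoc', mul_div_assoc', hba, hab]

lemma sub_le_mul_log_div {x y : ℝ} (hx : 0 < x) (hy : 0 < y) : x - y ≤ x * log (x / y) := by
  have h := mul_le_mul_of_nonneg_left (log_le_sub_one_of_pos (div_pos hy hx)) hx.le
  rw [mul_sub, mul_div_cancel₀ _ hx.ne', mul_one, ← inv_div, log_inv] at h
  linarith

/-- Theorem 1 of the paper in its continuous form: the ν-normalized weighted geometric
mean `g` of `f₁` and `f₂` minimizes `f ↦ KL(f‖f₁) + α·KL(f‖f₂)` over probability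
densities with respect to `ν`. -/
theorem density_weighted_KL_minimizer
    {Ω : Type*} [MeasurableSpace Ω] (ν : Measure Ω) [SigmaFinite ν]
    (α : ℝ) (hα : 0 < α) (f₁ f₂ : Ω → ℝ)
    (hf₁m : Measurable f₁) (hf₂m : Measurable f₂)
    (hf₁0 : ∀ z, 0 ≤ f₁ z) (hf₂0 : ∀ z, 0 ≤ f₂ z)
    (hf₁1 : ∫ z, f₁ z ∂ν = 1) (hf₂1 : ∫ z, f₂ z ∂ν = 1)
    (hf₁pos : ∀ᵐ z ∂ν, 0 < f₁ z) (hf₂pos : ∀ᵐ z ∂ν, 0 < f₂ z)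
    (hGint : Integrable (fun z => f₁ z ^ (1 / (α + 1)) * f₂ z ^ (α / (α + 1))) ν)
    (Z : ℝ) (hZ : Z = ∫ z, f₁ z ^ (1 / (α + 1)) * f₂ z ^ (α / (α + 1)) ∂ν)
    (hZpos : 0 < Z)
    (g : Ω → ℝ) (hg : ∀ z, g z = f₁ z ^ (1 / (α + 1)) * f₂ z ^ (α / (α + 1)) / Z) :
    ∀ f : Ω → ℝ, Measurable f → (∀ z, 0 ≤ f z) → ∫ z, f z ∂ν = 1 →
      Integrable (fun z => if f z = 0 then 0 else f z * Real.log (f z / f₁ z)) ν →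
      Integrable (fun z => if f z = 0 then 0 else f z * Real.log (f z / f₂ z)) ν →
      (∫ z, (if f z = 0 then 0 else f z * Real.log (f z / f₁ z)) ∂ν) +
        α * ∫ z, (if f z = 0 then 0 else f z * Real.log (f z / f₂ z)) ∂ν ≥
      (∫ z, (if g z = 0 then 0 else g z * Real.log (g z / f₁ z)) ∂ν) +
        α * ∫ z, (if g z = 0 then 0 else g z * Real.log (g z / f₂ z)) ∂ν := by
  intro f hfm hf0 hf1 hfi₁ hfi₂
  have hα1 : 0 < α + 1 := by linarith
  have hf₁i : Integrable f₁ ν := .of_integral_ne_zero (by simp [hf₁1])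
  have hf₂i : Integrable f₂ ν := .of_integral_ne_zero (by simp [hf₂1])
  have hfi : Integrable f ν := .of_integral_ne_zero (by simp [hf1])
  have hg' : g = fun z => f₁ z ^ (1 / (α + 1)) * f₂ z ^ (α / (α + 1)) / Z := funext hg
  have hgi : Integrable g ν := hg' ▸ hGint.div_const Z
  have hg1 : ∫ z, g z ∂ν = 1 := by
    rw [hg', integral_div, ← hZ, div_self hZpos.ne']
  have hgpos : ∀ᵐ z ∂ν, 0 < g z := by
    filter_upwards [hf₁pos, hf₂pos] with z h₁ h₂
    rw [hg]
    positivity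
  have hlog : ∀ᵐ z ∂ν, log (g z) = (log (f₁ z) + α * log (f₂ z)) / (α + 1) - log Z := by
    filter_upwards [hf₁pos, hf₂pos] with z h₁ h₂
    rw [hg, log_weighted_geom_mean_div hα h₁ h₂ hZpos]
  have hratio : Integrable (fun z => g z * log (f₂ z / f₁ z)) ν := by
    refine Integrable.mono' (((hf₂i.div_const (1 / (α + 1))).add
      (hf₁i.div_const (α / (α + 1)))).div_const Z)
      (hgi.aestronglyMeasurable.mul (hf₂m.div hf₁m).log.aestronglyMeasurable) ?_
    filter_upwards [hf₁pos, hf₂pos, hgpos] with z h₁ h₂ h₃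
    rw [norm_mul, norm_of_nonneg h₃.le, norm_eq_abs, hg, div_mul_eq_mul_div]
    exact div_le_div_of_nonneg_right (weighted_geom_mean_mul_abs_log_div_le (by positivity)
      (by positivity) (by field_simp; ring) h₁ h₂) hZpos.le
  have hg₁ : (fun z => if g z = 0 then 0 else g z * log (g z / f₁ z)) =ᵐ[ν]
      fun z => α / (α + 1) * (g z * log (f₂ z / f₁ z)) - log Z * g z := by
    filter_upwards [hf₁pos, hf₂pos, hgpos, hlog] with z h₁ h₂ h₃ h₄
    rw [if_neg h₃.ne', log_div h₃.ne' h₁.ne', log_div h₂.ne' h₁.ne', h₄]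
    field_simp
    ring
  have hg₂ : (fun z => if g z = 0 then 0 else g z * log (g z / f₂ z)) =ᵐ[ν]
      fun z => -(1 / (α + 1)) * (g z * log (f₂ z / f₁ z)) - log Z * g z := by
    filter_upwards [hf₁pos, hf₂pos, hgpos, hlog] with z h₁ h₂ h₃ h₄
    rw [if_neg h₃.ne', log_div h₃.ne' h₂.ne', log_div h₂.ne' h₁.ne', h₄]
    field_simp
    ring
  have hvalue : (∫ z, (if g z = 0 then 0 else g z * log (g z / f₁ z)) ∂ν) +
      α * ∫ z, (if g z = 0 then 0 else g z * log (g z / f₂ z)) ∂ν = -(α + 1) * log Z := by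
    rw [integral_congr_ae hg₁, integral_congr_ae hg₂,
      integral_sub (hratio.const_mul _) (hgi.const_mul _),
      integral_sub (hratio.const_mul _) (hgi.const_mul _),
      integral_const_mul, integral_const_mul, integral_const_mul, hg1]
    field_simp
    ring
  have hsub : Integrable (fun z => f z - g z) ν := hfi.sub hgi
  have hlower : ∫ z, ((α + 1) * (f z - g z) - (α + 1) * log Z * f z) ∂ν =
      -(α + 1) * log Z := by
    rw [integral_sub (hsub.const_mul _) (hfi.const_mul _), integral_const_mul,
      integral_const_mul, integral_sub hfi hgi, hf1, hg1]
    ring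
  rw [hvalue, ← hlower, ge_iff_le, ← integral_const_mul, ← integral_add hfi₁ (hfi₂.const_mul α)]
  refine integral_mono_ae ((hsub.const_mul _).sub (hfi.const_mul _))
    (hfi₁.add (hfi₂.const_mul α)) ?_
  filter_upwards [hf₁pos, hf₂pos, hgpos, hlog] with z h₁ h₂ h₃ h₄
  rcases (hf0 z).eq_or_lt with h | h
  · simp only [← h, if_true]
    nlinarith [mul_pos hα1 h₃]
  · rw [if_neg h.ne', if_neg h.ne', log_div h.ne' h₁.ne', log_div h.ne' h₂.ne']
    have h₅ := mul_le_mul_of_nonneg_left (sub_le_mul_log_div h h₃) hα1.le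
    have h₆ : (α + 1) * (f z * log (f z / g z)) =
        f z * (log (f z) - log (f₁ z)) + α * (f z * (log (f z) - log (f₂ z))) +
          (α + 1) * log Z * f z := by
      rw [log_div h.ne' h₃.ne', h₄]
      field_simp
      ring
    linarith
end
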